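/- Vague vanishing of the pressure in the hypersonic limit: let θ ∈ (0, π/2), a = tan θ, E₀' > 0, Ω = {(x,y) : x > 0, y > ax}, and for small ε > 0 define on Ω the piecewise-constant pressure p^ε(x,y) = p₀^ε = (ε/(ε+1))E₀' when x/y < 1/σ^ε and p^ε(x,y) = p₁^ε when x/y > 1/σ^ε, with the shock-polar data (σ^ε, p₁^ε). Then for every continuous ψ : ℝ² → ℝ with compact support, lim_{ε→0⁺} ∫_Ω p^ε(x,y)·ψ(x,y) dx dy = 0; that is, the measures p^ε·1_Ω L² converge vaguely to the zero measure (even though p₁^ε → sin²θ ≠ 0 pointwise on the shock layer). -/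

import Mathlib

open Filter Topology MeasureTheory

/-- Shock-polar root `u₁^ε = u(ε/(ε+2))`. -/
noncomputable def u1 (u : ℝ → ℝ) (ε : ℝ) : ℝ := u (ε / (ε + 2))

/-- Shock slope `σ^ε = (1 − u₁^ε)/(a·u₁^ε)`. -/
noncomputable def sig (a : ℝ) (u : ℝ → ℝ) (ε : ℝ) : ℝ := (1 - u1 u ε) / (a * u1 u ε)

/-- Shock angle `α^ε = arctan σ^ε`. -/
noncomputable def alph (a : ℝ) (u : ℝ → ℝ) (ε : ℝ) : ℝ := Real.arctan (sig a u ε)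

/-- Downstream pressure `p₁^ε = (2(ε+1)sin²α^ε − ε²E₀')/((ε+1)(ε+2))`. -/
noncomputable def pr1 (a E₀' : ℝ) (u : ℝ → ℝ) (ε : ℝ) : ℝ :=
  (2 * (ε + 1) * Real.sin (alph a u ε) ^ 2 - ε ^ 2 * E₀') / ((ε + 1) * (ε + 2))

/-- Upstream pressure `p₀^ε = (ε/(ε+1))·E₀'`. -/
noncomputable def pr0 (E₀' : ℝ) (ε : ℝ) : ℝ := (ε / (ε + 1)) * E₀'

/-- The shock slope tends to the slope of the wedge. -/
theorem tendsto_sig {θ : ℝ} (hθ : θ ∈ Set.Ioo 0 (Real.pi / 2)) {u : ℝ → ℝ}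
    (hu : ContinuousAt u 0) (hu0 : u 0 = Real.cos θ ^ 2) :
    Tendsto (sig (Real.tan θ) u) (𝓝 0) (𝓝 (Real.tan θ)) := by
  have hcos : 0 < Real.cos θ := Real.cos_pos_of_mem_Ioo ⟨by linarith [hθ.1, Real.pi_pos], hθ.2⟩
  have hsin : 0 < Real.sin θ := Real.sin_pos_of_mem_Ioo ⟨hθ.1, by linarith [hθ.2, Real.pi_pos]⟩
  have htan : 0 < Real.tan θ := Real.tan_pos_of_pos_of_lt_pi_div_two hθ.1 hθ.2
  have hlam : Tendsto (fun ε : ℝ => ε / (ε + 2)) (𝓝 0) (𝓝 0) := by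
    have : ContinuousAt (fun ε : ℝ => ε / (ε + 2)) 0 := by
      fun_prop (disch := norm_num)
    simpa [ContinuousAt] using this
  have hu1 : Tendsto (u1 u) (𝓝 0) (𝓝 (Real.cos θ ^ 2)) := hu0 ▸ hu.tendsto.comp hlam
  have hlim := (hu1.const_sub 1).div (hu1.const_mul (Real.tan θ)) (by positivity)
  have hval : (1 - Real.cos θ ^ 2) / (Real.tan θ * Real.cos θ ^ 2) = Real.tan θ := by
    rw [← Real.sin_sq, Real.tan_eq_sin_div_cos]
    field_simp
  rwa [hval] at hlim

theorem abs_pr0_le {E₀' ε : ℝ} (hE : 0 ≤ E₀') (hε : 0 ≤ ε) : |pr0 E₀' ε| ≤ E₀' := by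
  have h : ε / (ε + 1) ≤ 1 := (div_le_one (by positivity)).2 (by linarith)
  rw [pr0, abs_of_nonneg (by positivity)]
  exact mul_le_of_le_one_left hE h

theorem abs_pr1_le (a : ℝ) {E₀' ε : ℝ} (u : ℝ → ℝ) (hE : 0 ≤ E₀') (hε : 0 ≤ ε) :
    |pr1 a E₀' u ε| ≤ 1 + E₀' := by
  have hs := Real.sin_sq_le_one (alph a u ε)
  have hs0 := sq_nonneg (Real.sin (alph a u ε))
  have hden : 0 < (ε + 1) * (ε + 2) := by positivity
  have hεE : 0 ≤ ε * E₀' := by positivity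
  have hεs : (ε + 1) * Real.sin (alph a u ε) ^ 2 ≤ ε + 1 :=
    mul_le_of_le_one_right (by positivity) hs
  have hεs0 : 0 ≤ (ε + 1) * Real.sin (alph a u ε) ^ 2 := by positivity
  have hεεE : 0 ≤ ε ^ 2 * E₀' := by positivity
  rw [pr1, abs_div, abs_of_pos hden, div_le_iff₀ hden, abs_le]
  constructor <;> nlinarith [sq_nonneg ε]

theorem tendsto_pr0 (E₀' : ℝ) : Tendsto (pr0 E₀') (𝓝 0) (𝓝 0) := by
  have : ContinuousAt (pr0 E₀') 0 := by
    unfold pr0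
    fun_prop (disch := norm_num)
  simpa [ContinuousAt, pr0] using this

/-- Vague vanishing of the pressure in the hypersonic limit. With
`θ ∈ (0, π/2)`, `a = tan θ`, `E₀' > 0`, `Ω = {(x,y) : x > 0, y > ax}`, and the
piecewise-constant pressure `p^ε = p₀^ε` on `{x/y < 1/σ^ε}`, `= p₁^ε` on `{x/y > 1/σ^ε}`,
for every continuous compactly supported `ψ : ℝ² → ℝ`,
`∫_Ω p^ε ψ dx dy → 0` as `ε → 0⁺`; i.e. `p^ε·1_Ω L²` converges vaguely to the zero measure
(even though `p₁^ε → sin²θ ≠ 0` pointwise on the shock layer). -/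
theorem hypersonic_limit_pressure_vague_vanishing
    (θ a E₀' lam₀ : ℝ) (hθ : θ ∈ Set.Ioo 0 (Real.pi / 2)) (ha : a = Real.tan θ)
    (hE : 0 < E₀') (hlam₀ : 0 < lam₀)
    (u : ℝ → ℝ) (hu : ContDiffOn ℝ 1 u (Set.Ioo (-lam₀) lam₀))
    (hu0 : u 0 = Real.cos θ ^ 2)
    (huH : ∀ lam ∈ Set.Ioo (-lam₀) lam₀,
      (1 - u lam) ^ 2 * (u lam - lam - 2 * lam * E₀')
        - a ^ 2 * (u lam) ^ 2 * (1 - u lam + 2 * lam * E₀') = 0)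
    (ψ : ℝ × ℝ → ℝ) (hψ : Continuous ψ) (hsupp : HasCompactSupport ψ) :
    Tendsto (fun ε : ℝ =>
        ∫ q in {q : ℝ × ℝ | 0 < q.1 ∧ a * q.1 < q.2},
          (if q.1 / q.2 < 1 / sig a u ε then pr0 E₀' ε else pr1 a E₀' u ε) * ψ q)
      (𝓝[>] 0) (𝓝 0) := by
  subst ha
  have htan : 0 < Real.tan θ := Real.tan_pos_of_pos_of_lt_pi_div_two hθ.1 hθ.2
  have hu_cont : ContinuousAt u 0 :=
    hu.continuousOn.continuousAt (Ioo_mem_nhds (by linarith) hlam₀)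
  have hsig := (tendsto_sig hθ hu_cont hu0).mono_left
    (nhdsWithin_le_nhds : 𝓝[>] (0 : ℝ) ≤ 𝓝 0)
  have hpr0 := (tendsto_pr0 E₀').mono_left (nhdsWithin_le_nhds : 𝓝[>] (0 : ℝ) ≤ 𝓝 0)
  have hΩ : MeasurableSet {q : ℝ × ℝ | 0 < q.1 ∧ Real.tan θ * q.1 < q.2} :=
    (measurableSet_lt measurable_const measurable_fst).inter
      (measurableSet_lt (measurable_fst.const_mul _) measurable_snd)
  have hzero : ∫ _ in {q : ℝ × ℝ | 0 < q.1 ∧ Real.tan θ * q.1 < q.2}, (0 : ℝ) = 0 :=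
    integral_zero _ _
  suffices h : Tendsto _ (𝓝[>] (0 : ℝ))
      (𝓝 (∫ _ in {q : ℝ × ℝ | 0 < q.1 ∧ Real.tan θ * q.1 < q.2}, (0 : ℝ))) by
    rwa [hzero] at h
  refine tendsto_integral_filter_of_dominated_convergence (fun q => (1 + E₀') * ‖ψ q‖) ?_ ?_ ?_ ?_
  · refine Eventually.of_forall fun ε => Measurable.aestronglyMeasurable ?_
    exact (Measurable.ite (measurableSet_lt (measurable_fst.div measurable_snd) measurable_const)
      measurable_const measurable_const).mul hψ.measurable
  · filter_upwards [self_mem_nhdsWithin] with ε hε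
    refine Eventually.of_forall fun q => ?_
    rw [norm_mul]
    refine mul_le_mul_of_nonneg_right ?_ (norm_nonneg _)
    split_ifs
    · exact (abs_pr0_le hE.le hε.le).trans (by linarith)
    · exact abs_pr1_le _ u hE.le hε.le
  · exact (hψ.integrable_of_hasCompactSupport hsupp).norm.const_mul _ |>.integrableOn
  · refine ae_restrict_of_forall_mem hΩ fun q hq => ?_
    have hq2 : 0 < q.2 := (mul_pos htan hq.1).trans hq.2
    have hlt : q.1 / q.2 < 1 / Real.tan θ := by
      rw [div_lt_div_iff₀ hq2 htan]
      linarith [hq.2]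
    have hinv : Tendsto (fun ε => 1 / sig (Real.tan θ) u ε) (𝓝[>] 0) (𝓝 (1 / Real.tan θ)) :=
      tendsto_const_nhds.div hsig htan.ne'
    have hev := hinv.eventually (lt_mem_nhds hlt)
    have hlim := hpr0.mul_const (ψ q)
    rw [zero_mul] at hlim
    refine hlim.congr' ?_
    filter_upwards [hev] with ε hε
    rw [if_pos hε]
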